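/- Let S : ℤ × ℝ → 𝕊² and U : ℤ × ℝ → 𝕊² be global good solutions of the lattice Heisenberg model with S_n(0) = U_n(0) for all n ∈ ℤ. Then S_n(t) = U_n(t) for all n ∈ ℤ and all t ∈ ℝ. -/

import Mathlib

open MeasureTheory Metric
open scoped ENNReal BigOperators
noncomputable section

/-- Euclidean 3-space. -/
abbrev R3 := EuclideanSpace ℝ (Fin 3)

/-- The unit sphere 𝕊² ⊂ ℝ³. -/
abbrev Sph := Metric.sphere (0 : R3) 1

/-- The dot product on ℝ³. -/
def vdot (a b : R3) : ℝ := inner ℝ a b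

/-- The cross product on ℝ³. -/
def vcross (a b : R3) : R3 :=
  (WithLp.equiv 2 (Fin 3 → ℝ)).symm
    (crossProduct ((WithLp.equiv 2 (Fin 3 → ℝ)) a) ((WithLp.equiv 2 (Fin 3 → ℝ)) b))

/-- The japanese bracket ⟨n⟩ = (1+n²)^{1/2}. -/
def jap (n : ℤ) : ℝ := Real.sqrt (1 + (n : ℝ)^2)

/-- A global solution of the lattice Heisenberg model
`(d/dt) S_n = − S_n × ( 2 S_{n+1}/(1+S_n·S_{n+1}) + 2 S_{n−1}/(1+S_n·S_{n−1}) )`: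
each spin is a unit vector, consecutive spins are never antiparallel, each `t ↦ S_n(t)` is
differentiable and the ODE holds for all `n` and `t`. -/
def IsLHMSolution (S : ℤ → ℝ → R3) : Prop :=
  (∀ n t, vdot (S n t) (S n t) = 1) ∧
  (∀ n t, 1 + vdot (S n t) (S (n+1) t) ≠ 0) ∧
  (∀ n t, HasDerivAt (S n)
    (-(vcross (S n t)
        ((2/(1 + vdot (S n t) (S (n+1) t))) • S (n+1) t
          + (2/(1 + vdot (S n t) (S (n-1) t))) • S (n-1) t))) t)

/-- A good solution of the lattice Heisenberg model: a global solution satisfying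
(i) ∃ p > q > 1 with ∫_{−T}^{T} Σ_n ⟨n⟩^{−q} (1+S_n·S_{n+1})^{−p} dt < ∞ for all T > 0, and
(ii) ∃ c > 0 with sup_{|t|≤T} Σ_n e^{−c⟨n⟩} (1+S_n·S_{n+1})^{−1} < ∞ for all T > 0. -/
def IsGoodLHMSolution (S : ℤ → ℝ → R3) : Prop :=
  IsLHMSolution S ∧
  (∃ p q : ℝ, 1 < q ∧ q < p ∧ ∀ T > (0:ℝ),
    (∫⁻ t in Set.Icc (-T) T, ∑' n : ℤ,
      ENNReal.ofReal (jap n ^ (-q) * (1 + vdot (S n t) (S (n+1) t)) ^ (-p))) < ⊤) ∧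
  (∃ c > (0:ℝ), ∀ T > (0:ℝ),
    (⨆ t ∈ Set.Icc (-T) T, ∑' n : ℤ,
      ENNReal.ofReal (Real.exp (-(c * jap n)) * (1 + vdot (S n t) (S (n+1) t))⁻¹)) < ⊤)

/-- A solution of the lattice Heisenberg model whose truncated weighted inverse bond weights are
bounded in `L¹` in time, uniformly in the truncation. -/
structure HasBondBound (S : ℤ → ℝ → R3) (p q : ℝ) : Prop where
  solution : IsLHMSolution S
  one_lt : 1 < q
  lt : q < p
  bound : ∀ T > (0 : ℝ), ∃ C : ℝ, ∀ M : ℕ,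
    ∫ t in (-T)..T, ∑ n ∈ Finset.Icc (-(M : ℤ)) M,
      jap n ^ (-q) * (1 + vdot (S n t) (S (n + 1) t)) ^ (-p) ≤ C

lemma vcross_sub_left (a b c : R3) : vcross (a - b) c = vcross a c - vcross b c := by
  simp [vcross]

lemma vcross_sub_right (a b c : R3) : vcross a (b - c) = vcross a b - vcross a c := by
  simp [vcross]

lemma vcross_add_right (a b c : R3) : vcross a (b + c) = vcross a b + vcross a c := by
  simp [vcross]

lemma vcross_smul_right (r : ℝ) (a b : R3) : vcross a (r • b) = r • vcross a b := by
  simp [vcross]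

lemma vcross_self (a : R3) : vcross a a = 0 := by
  simp [vcross]

lemma vdot_comm (a b : R3) : vdot a b = vdot b a := real_inner_comm _ _

lemma norm_eq_one_of_vdot_self {a : R3} (h : vdot a a = 1) : ‖a‖ = 1 := by
  unfold vdot at h
  rw [real_inner_self_eq_norm_sq] at h
  nlinarith [norm_nonneg a]

lemma norm_vcross_sq_add_vdot_sq (a b : R3) :
    ‖vcross a b‖ ^ 2 + vdot a b ^ 2 = (‖a‖ * ‖b‖) ^ 2 := by
  rw [mul_pow, EuclideanSpace.norm_sq_eq, EuclideanSpace.norm_sq_eq, EuclideanSpace.norm_sq_eq]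
  simp [vcross, vdot, Fin.sum_univ_three, PiLp.inner_apply, crossProduct]
  ring

lemma norm_vcross_le (a b : R3) : ‖vcross a b‖ ≤ ‖a‖ * ‖b‖ := by
  refine abs_le_of_sq_le_sq' ?_ (by positivity) |>.2
  nlinarith [norm_vcross_sq_add_vdot_sq a b, sq_nonneg (vdot a b)]

lemma norm_add_sq_of_unit {a b : R3} (ha : ‖a‖ = 1) (hb : ‖b‖ = 1) :
    ‖a + b‖ ^ 2 = 2 * (1 + vdot a b) := by
  rw [norm_add_sq_real, ha, hb, vdot]
  ring

lemma continuous_vcross : Continuous fun x : R3 × R3 => vcross x.1 x.2 := by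
  refine (PiLp.continuous_toLp 2 _).comp (continuous_pi fun i => ?_)
  fin_cases i <;> simp [crossProduct] <;> fun_prop

/-- The bond interaction is Lipschitz, with constant controlled by the inverse bond weights. -/
lemma norm_bond_sub_le {a b c d : R3} (ha : ‖a‖ = 1) (hb : ‖b‖ = 1) (hc : ‖c‖ = 1)
    (hd : ‖d‖ = 1) (hab : 0 < 1 + vdot a b) (hcd : 0 < 1 + vdot c d) :
    ‖(2 / (1 + vdot a b)) • vcross a b - (2 / (1 + vdot c d)) • vcross c d‖ ≤
      5 * ((1 + vdot a b)⁻¹ + (1 + vdot c d)⁻¹) * (‖a - c‖ + ‖b - d‖) := by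
  have hx := norm_add_sq_of_unit ha hb
  have hy := norm_add_sq_of_unit hc hd
  set x := ‖a + b‖ with hxdef
  set y := ‖c + d‖ with hydef
  set δ := ‖a - c‖ + ‖b - d‖ with hδ
  have hδ0 : 0 ≤ δ := by positivity
  have hx0 : 0 < x := lt_of_le_of_ne (norm_nonneg _) fun h => by
    rw [← h] at hx; nlinarith
  have hy0 : 0 < y := lt_of_le_of_ne (norm_nonneg _) fun h => by
    rw [← h] at hy; nlinarith
  have hX : 1 + vdot a b = x ^ 2 / 2 := by linarith
  have hY : 1 + vdot c d = y ^ 2 / 2 := by linarith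
  rw [hX, hY]
  have hxy : |x - y| ≤ δ := by
    calc |x - y| ≤ ‖(a + b) - (c + d)‖ := abs_norm_sub_norm_le _ _
      _ = ‖(a - c) + (b - d)‖ := by congr 1; abel
      _ ≤ δ := norm_add_le _ _
  have hcross : ‖vcross a b - vcross c d‖ ≤ δ := by
    have : vcross a b - vcross c d = vcross (a - c) b + vcross c (b - d) := by
      rw [vcross_sub_left, vcross_sub_right]; abel
    rw [this]
    refine (norm_add_le _ _).trans ?_
    have h1 := norm_vcross_le (a - c) b
    have h2 := norm_vcross_le c (b - d)
    rw [hb] at h1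
    rw [hc] at h2
    linarith
  have hcy : ‖vcross c d‖ ≤ y := by
    have h : vcross c d = vcross c (c + d) := by rw [vcross_add_right, vcross_self, zero_add]
    rw [h]
    simpa [hc] using norm_vcross_le c (c + d)
  have hsplit : (2 / (x ^ 2 / 2)) • vcross a b - (2 / (y ^ 2 / 2)) • vcross c d =
      (4 / x ^ 2) • (vcross a b - vcross c d) +
        (4 * (y - x) * (x + y) / (x ^ 2 * y ^ 2)) • vcross c d := by
    have h1 : 2 / (x ^ 2 / 2) = 4 / x ^ 2 := by field_simp; norm_num
    have h2 : 2 / (y ^ 2 / 2) = 4 / x ^ 2 - 4 * (y - x) * (x + y) / (x ^ 2 * y ^ 2) := by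
      field_simp; ring
    rw [h1, h2, smul_sub, sub_smul]
    abel
  have hcoef : ‖4 * (y - x) * (x + y) / (x ^ 2 * y ^ 2)‖ ≤
      4 * δ * (x + y) / (x ^ 2 * y ^ 2) := by
    rw [Real.norm_eq_abs, abs_div, abs_mul, abs_mul, abs_of_pos (by positivity : 0 < x ^ 2 * y ^ 2),
      abs_of_pos (by positivity : 0 < x + y), abs_of_pos (by norm_num : (0 : ℝ) < 4), abs_sub_comm]
    gcongr
  rw [hsplit]
  calc _ ≤ 4 / x ^ 2 * δ + 4 * δ * (x + y) / (x ^ 2 * y ^ 2) * y := by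
        refine (norm_add_le _ _).trans ?_
        rw [norm_smul, norm_smul]
        have h4 : ‖4 / x ^ 2‖ = 4 / x ^ 2 := abs_of_pos (by positivity)
        rw [h4]
        gcongr
    _ ≤ _ := by
        have : 5 * ((x ^ 2 / 2)⁻¹ + (y ^ 2 / 2)⁻¹) * δ -
            (4 / x ^ 2 * δ + 4 * δ * (x + y) / (x ^ 2 * y ^ 2) * y) =
            δ * (2 * (x - y) ^ 2 + 8 * x ^ 2) / (x ^ 2 * y ^ 2) := by
          field_simp
          ring
        have h : 0 ≤ δ * (2 * (x - y) ^ 2 + 8 * x ^ 2) / (x ^ 2 * y ^ 2) := by positivity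
        linarith

lemma one_le_jap (n : ℤ) : 1 ≤ jap n := by
  unfold jap
  rw [Real.one_le_sqrt]
  nlinarith [sq_nonneg (n : ℝ)]

lemma jap_le_one_add_abs (n : ℤ) : jap n ≤ 1 + |(n : ℝ)| := by
  unfold jap
  rw [Real.sqrt_le_left (by positivity)]
  nlinarith [sq_abs (n : ℝ), abs_nonneg (n : ℝ)]

lemma inv_le_rpow_mul_one_add {x j r p q : ℝ} (hx : 0 < x) (hj : 1 ≤ j) (hjr : j ≤ r)
    (hq : 1 < q) (hqp : q < p) :
    x⁻¹ ≤ r ^ (q / p) * (1 + j ^ (-q) * x ^ (-p)) := by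
  have hp : 1 < p := hq.trans hqp
  have hj0 : 0 < j := by linarith
  have hr0 : 0 < r := by linarith
  have hX : 0 ≤ j ^ (-q) * x ^ (-p) := by positivity
  have h1 : x⁻¹ = j ^ (q / p) * (j ^ (-q) * x ^ (-p)) ^ (1 / p) := by
    rw [Real.mul_rpow (by positivity) (by positivity), ← Real.rpow_mul hj0.le,
      ← Real.rpow_mul hx.le, ← mul_assoc, ← Real.rpow_add hj0, ← Real.rpow_neg_one]
    have e1 : q / p + -q * (1 / p) = 0 := by ring
    have e2 : -p * (1 / p) = -1 := by field_simp
    rw [e1, e2, Real.rpow_zero, one_mul]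
  rw [h1]
  have h2 : (j ^ (-q) * x ^ (-p)) ^ (1 / p) ≤ 1 + j ^ (-q) * x ^ (-p) := by
    calc _ ≤ (1 + j ^ (-q) * x ^ (-p)) ^ (1 / p) := by
          apply Real.rpow_le_rpow hX (by linarith) (by positivity)
      _ ≤ (1 + j ^ (-q) * x ^ (-p)) ^ (1 : ℝ) := by
          apply Real.rpow_le_rpow_of_exponent_le (by linarith)
          rw [div_le_one (by linarith)]; exact hp.le
      _ = _ := Real.rpow_one _
  have h3 : j ^ (q / p) ≤ r ^ (q / p) :=
    Real.rpow_le_rpow hj0.le hjr (div_nonneg (by linarith) (by linarith))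
  gcongr

section Solution

variable {S : ℤ → ℝ → R3}

lemma IsLHMSolution.norm_eq_one (hS : IsLHMSolution S) (n : ℤ) (t : ℝ) : ‖S n t‖ = 1 :=
  norm_eq_one_of_vdot_self (hS.1 n t)

lemma IsLHMSolution.continuous (hS : IsLHMSolution S) (n : ℤ) : Continuous (S n) :=
  continuous_iff_continuousAt.2 fun t => (hS.2.2 n t).continuousAt

lemma IsLHMSolution.bond_pos (hS : IsLHMSolution S) (n : ℤ) (t : ℝ) :
    0 < 1 + vdot (S n t) (S (n + 1) t) := by
  refine lt_of_le_of_ne ?_ (hS.2.1 n t).symm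
  have := norm_add_sq_of_unit (hS.norm_eq_one n t) (hS.norm_eq_one (n + 1) t)
  nlinarith [sq_nonneg ‖S n t + S (n + 1) t‖]

lemma IsLHMSolution.bond_pos' (hS : IsLHMSolution S) (n : ℤ) (t : ℝ) :
    0 < 1 + vdot (S n t) (S (n - 1) t) := by
  have := hS.bond_pos (n - 1) t
  rwa [sub_add_cancel, vdot_comm] at this

lemma IsLHMSolution.continuous_truncation (hS : IsLHMSolution S) (p q : ℝ) (M : ℕ) :
    Continuous fun t => ∑ n ∈ Finset.Icc (-(M : ℤ)) M,
      jap n ^ (-q) * (1 + vdot (S n t) (S (n + 1) t)) ^ (-p) := by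
  refine continuous_finsetSum _ fun n _ => continuous_const.mul ?_
  refine Continuous.rpow_const ?_ fun t => Or.inl (hS.bond_pos n t).ne'
  exact continuous_const.add ((hS.continuous n).inner (hS.continuous (n + 1)))

lemma HasBondBound.of_good (hS : IsGoodLHMSolution S) : ∃ p q, HasBondBound S p q := by
  obtain ⟨hsol, ⟨p, q, hq, hqp, hint⟩, -⟩ := hS
  refine ⟨p, q, hsol, hq, hqp, fun T hT => ⟨(∫⁻ t in Set.Icc (-T) T, ∑' n : ℤ,
      ENNReal.ofReal (jap n ^ (-q) * (1 + vdot (S n t) (S (n + 1) t)) ^ (-p))).toReal,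
    fun M => ?_⟩⟩
  have hnn : ∀ n t, 0 ≤ jap n ^ (-q) * (1 + vdot (S n t) (S (n + 1) t)) ^ (-p) := fun n t => by
    have h1 := hsol.bond_pos n t
    have h2 := one_le_jap n
    positivity
  have hcont := hsol.continuous_truncation p q M
  rw [intervalIntegral.integral_of_le (by linarith), ← integral_Icc_eq_integral_Ioc]
  refine (ENNReal.ofReal_le_iff_le_toReal (hint T hT).ne).1 ?_
  rw [ofReal_integral_eq_lintegral_ofReal
    (hcont.continuousOn.integrableOn_compact isCompact_Icc)
    (Filter.Eventually.of_forall fun t => Finset.sum_nonneg fun n _ => hnn n t)]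
  refine lintegral_mono fun t => ?_
  rw [ENNReal.ofReal_sum_of_nonneg fun n _ => hnn n t]
  exact ENNReal.sum_le_tsum _

lemma IsLHMSolution.reverse (hS : IsLHMSolution S) : IsLHMSolution fun n t => -S n (-t) := by
  have hdot : ∀ a b : R3, vdot (-a) (-b) = vdot a b := fun a b => by simp [vdot]
  refine ⟨fun n t => ?_, fun n t => ?_, fun n t => ?_⟩
  · rw [hdot]; exact hS.1 n _
  · rw [hdot]; exact hS.2.1 n _
  · have h : HasDerivAt (fun t => -S n (-t)) _ t :=
      ((hS.2.2 n (-t)).scomp t (hasDerivAt_neg t)).neg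
    refine h.congr_deriv ?_
    simp only [hdot]
    simp [vcross, add_comm]

lemma HasBondBound.reverse {p q : ℝ} (hS : HasBondBound S p q) :
    HasBondBound (fun n t => -S n (-t)) p q := by
  refine ⟨hS.solution.reverse, hS.one_lt, hS.lt, fun T hT => ?_⟩
  obtain ⟨C, hC⟩ := hS.bound T hT
  refine ⟨C, fun M => le_trans (le_of_eq ?_) (hC M)⟩
  have h := intervalIntegral.integral_comp_neg (a := -T) (b := T)
    (fun t => ∑ n ∈ Finset.Icc (-(M : ℤ)) M,
      jap n ^ (-q) * (1 + vdot (S n t) (S (n + 1) t)) ^ (-p))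
  rw [neg_neg] at h
  rw [← h]
  simp [vdot]

lemma HasBondBound.inv_bond_le {p q : ℝ} (hS : HasBondBound S p q) {M : ℕ} {n : ℤ}
    (hn : n ∈ Finset.Icc (-(M : ℤ)) M) (t : ℝ) :
    (1 + vdot (S n t) (S (n + 1) t))⁻¹ ≤ ((M : ℝ) + 1) ^ (q / p) *
      (1 + ∑ n ∈ Finset.Icc (-(M : ℤ)) M,
        jap n ^ (-q) * (1 + vdot (S n t) (S (n + 1) t)) ^ (-p)) := by
  have hj : jap n ≤ (M : ℝ) + 1 := by
    have h1 := jap_le_one_add_abs n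
    rw [Finset.mem_Icc] at hn
    have h2 : |(n : ℝ)| ≤ M := by exact_mod_cast abs_le.2 hn
    linarith
  refine (inv_le_rpow_mul_one_add (hS.solution.bond_pos n t) (one_le_jap n) hj
    hS.one_lt hS.lt).trans ?_
  gcongr
  refine Finset.single_le_sum (f := fun n => jap n ^ (-q) *
    (1 + vdot (S n t) (S (n + 1) t)) ^ (-p)) (fun i _ => ?_) hn
  have h1 := hS.solution.bond_pos i t
  have h2 := one_le_jap i
  positivity

end Solution

/-- Iterated Grönwall estimate for a nearest-neighbour system of differential inequalities. -/
lemma norm_le_pow_div_factorial {E : Type*} [NormedAddCommGroup E] [NormedSpace ℝ E]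
    {f f' : ℤ → ℝ → E} {m : ℝ → ℝ} {M : ℕ} {B : ℝ} (hm : Continuous m) (hm0 : ∀ t, 0 ≤ m t)
    (hf : ∀ n t, HasDerivAt (f n) (f' n t) t) (hf0 : ∀ n, f n 0 = 0) (hB : ∀ n t, ‖f n t‖ ≤ B)
    (hbd : ∀ (n : ℤ) t, |n| < M →
      ‖f' n t‖ ≤ m t * (‖f (n - 1) t‖ + ‖f n t‖ + ‖f (n + 1) t‖)) (k : ℕ) :
    ∀ (n : ℤ) (t : ℝ), 0 ≤ t → |n| + k ≤ M →
      ‖f n t‖ ≤ B * (3 * ∫ s in (0 : ℝ)..t, m s) ^ k / k.factorial := by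
  induction k with
  | zero => intro n t _ _; simpa using hB n t
  | succ k ih =>
    intro n T hT hn
    push_cast at hn
    set L : ℝ → ℝ := fun t => ∫ s in (0 : ℝ)..t, m s with hL
    have hLd : ∀ t, HasDerivAt L (m t) t := fun t =>
      intervalIntegral.integral_hasDerivAt_right (hm.intervalIntegrable _ _)
        (hm.stronglyMeasurableAtFilter _ _) hm.continuousAt
    have hGd : ∀ t, HasDerivAt (fun t => B * (3 * L t) ^ (k + 1) / (k + 1).factorial)
        (m t * (3 * (B * (3 * L t) ^ k / k.factorial))) t := fun t => by
      have h := ((((hLd t).const_mul 3).pow (k + 1)).const_mul B).div_const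
        ((k + 1).factorial : ℝ)
      refine h.congr_deriv ?_
      have : (k.factorial : ℝ) ≠ 0 := by positivity
      have : (k : ℝ) + 1 ≠ 0 := by positivity
      rw [Nat.factorial_succ]
      push_cast
      field_simp
    refine image_norm_le_of_norm_deriv_right_le_deriv_boundary (a := 0) (b := T)
      (f' := f' n) (B' := fun t => m t * (3 * (B * (3 * L t) ^ k / k.factorial)))
      (fun t _ => (hf n t).continuousAt.continuousWithinAt)
      (fun t _ => (hf n t).hasDerivWithinAt) (by simp [hf0, hL]) hGd ?_ ⟨hT, le_rfl⟩
    intro t ht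
    have h1 : |n - 1| ≤ |n| + 1 := by simpa using abs_sub n 1
    have h2 : |n + 1| ≤ |n| + 1 := by simpa using abs_add_le n 1
    refine (hbd n t (by linarith)).trans (mul_le_mul_of_nonneg_left ?_ (hm0 t))
    have e1 := ih (n - 1) t ht.1 (by linarith)
    have e2 := ih n t ht.1 (by linarith)
    have e3 := ih (n + 1) t ht.1 (by linarith)
    linarith

/-- A factorial beats the powers of a sublinearly growing quantity. -/
lemma tendsto_sublinear_pow_div_factorial {C α b : ℝ} (hC : 0 ≤ C) (hα0 : 0 < α) (hα : α < 1)
    (hb : 0 ≤ b) :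
    Filter.Tendsto (fun k : ℕ => (C * ((k : ℝ) + b) ^ α) ^ k / k.factorial) Filter.atTop
      (nhds 0) := by
  have hratio : Filter.Tendsto (fun k : ℕ => Real.exp 1 * C * (1 + b) ^ α * (k : ℝ) ^ (-(1 - α)))
      Filter.atTop (nhds 0) := by
    simpa using ((tendsto_rpow_neg_atTop (sub_pos.2 hα)).comp
      tendsto_natCast_atTop_atTop).const_mul (Real.exp 1 * C * (1 + b) ^ α)
  have hhalf : Filter.Tendsto (fun k : ℕ => (1 / 2 : ℝ) ^ k) Filter.atTop (nhds 0) :=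
    tendsto_pow_atTop_nhds_zero_of_lt_one (by norm_num) (by norm_num)
  refine squeeze_zero' (Filter.Eventually.of_forall fun k => by positivity) ?_ hhalf
  filter_upwards [hratio.eventually_le_const (by norm_num : (0 : ℝ) < 1 / 2),
    Filter.eventually_ge_atTop 1] with k hk hk1
  have hk1' : (1 : ℝ) ≤ k := by exact_mod_cast hk1
  have hk0 : (0 : ℝ) < k := by linarith
  have hfact : (1 : ℝ) / k.factorial ≤ Real.exp 1 ^ k / (k : ℝ) ^ k := by
    have h := Real.pow_div_factorial_le_exp (k : ℝ) hk0.le k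
    rw [← Real.exp_one_pow] at h
    rw [le_div_iff₀ (by positivity), one_div_mul_eq_div]
    exact h
  have hbase : ((k : ℝ) + b) ^ α ≤ (1 + b) ^ α * (k : ℝ) ^ α := by
    rw [← Real.mul_rpow (by positivity) hk0.le]
    exact Real.rpow_le_rpow (by positivity) (by nlinarith) hα0.le
  have hpow : (k : ℝ) ^ (-(1 - α)) = (k : ℝ) ^ α / k := by
    rw [neg_sub, Real.rpow_sub_one hk0.ne']
  calc (C * ((k : ℝ) + b) ^ α) ^ k / k.factorial
      = (C * ((k : ℝ) + b) ^ α) ^ k * (1 / k.factorial) := by ring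
    _ ≤ (C * ((1 + b) ^ α * (k : ℝ) ^ α)) ^ k * (Real.exp 1 ^ k / (k : ℝ) ^ k) := by gcongr
    _ = (Real.exp 1 * C * (1 + b) ^ α * (k : ℝ) ^ (-(1 - α))) ^ k := by
        rw [hpow, ← div_pow, ← mul_pow]
        congr 1
        ring
    _ ≤ (1 / 2) ^ k := by gcongr

lemma IsLHMSolution.norm_field_sub_le {S U : ℤ → ℝ → R3} (hS : IsLHMSolution S)
    (hU : IsLHMSolution U) {n : ℤ} {t Y : ℝ}
    (hn : (1 + vdot (S n t) (S (n + 1) t))⁻¹ + (1 + vdot (U n t) (U (n + 1) t))⁻¹ ≤ Y)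
    (hn' : (1 + vdot (S (n - 1) t) (S (n - 1 + 1) t))⁻¹ +
      (1 + vdot (U (n - 1) t) (U (n - 1 + 1) t))⁻¹ ≤ Y) :
    ‖-(vcross (S n t) ((2 / (1 + vdot (S n t) (S (n + 1) t))) • S (n + 1) t
          + (2 / (1 + vdot (S n t) (S (n - 1) t))) • S (n - 1) t))
      - -(vcross (U n t) ((2 / (1 + vdot (U n t) (U (n + 1) t))) • U (n + 1) t
          + (2 / (1 + vdot (U n t) (U (n - 1) t))) • U (n - 1) t))‖ ≤
      10 * Y * (‖S (n - 1) t - U (n - 1) t‖ + ‖S n t - U n t‖ + ‖S (n + 1) t - U (n + 1) t‖) := by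
  rw [sub_add_cancel, vdot_comm (S (n - 1) t), vdot_comm (U (n - 1) t)] at hn'
  have h1 := norm_bond_sub_le (hS.norm_eq_one n t) (hS.norm_eq_one (n + 1) t)
    (hU.norm_eq_one n t) (hU.norm_eq_one (n + 1) t) (hS.bond_pos n t) (hU.bond_pos n t)
  have h2 := norm_bond_sub_le (hS.norm_eq_one n t) (hS.norm_eq_one (n - 1) t)
    (hU.norm_eq_one n t) (hU.norm_eq_one (n - 1) t) (hS.bond_pos' n t) (hU.bond_pos' n t)
  have hY : 0 ≤ Y := by
    have := hS.bond_pos n t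
    have := hU.bond_pos n t
    exact le_trans (by positivity) hn
  simp only [vcross_add_right, vcross_smul_right]
  rw [neg_sub_neg, norm_sub_rev, add_sub_add_comm]
  refine (norm_add_le _ _).trans ((add_le_add h1 h2).trans ?_)
  have e1 := mul_le_mul_of_nonneg_right hn
    (by positivity : 0 ≤ ‖S n t - U n t‖ + ‖S (n + 1) t - U (n + 1) t‖)
  have e2 := mul_le_mul_of_nonneg_right hn'
    (by positivity : 0 ≤ ‖S n t - U n t‖ + ‖S (n - 1) t - U (n - 1) t‖)
  have e3 := mul_nonneg hY (norm_nonneg (S (n + 1) t - U (n + 1) t))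
  have e4 := mul_nonneg hY (norm_nonneg (S (n - 1) t - U (n - 1) t))
  nlinarith

lemma HasBondBound.eq_of_pos {S U : ℤ → ℝ → R3} {p q p' q' : ℝ} (hS : HasBondBound S p q)
    (hU : HasBondBound U p' q') (h0 : ∀ n, S n 0 = U n 0) (n : ℤ) {T : ℝ} (hT : 0 < T) :
    S n T = U n T := by
  obtain ⟨C, hC⟩ := hS.bound T hT
  obtain ⟨C', hC'⟩ := hU.bound T hT
  set α := max (q / p) (q' / p') with hα
  have hp : 0 < p := by linarith [hS.one_lt, hS.lt]
  have hp' : 0 < p' := by linarith [hU.one_lt, hU.lt]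
  have hα1 : α < 1 := max_lt ((div_lt_one hp).2 hS.lt) ((div_lt_one hp').2 hU.lt)
  have hα0 : 0 < α := lt_max_of_lt_left (div_pos (by linarith [hS.one_lt]) hp)
  set FS : ℕ → ℝ → ℝ := fun M t => ∑ n ∈ Finset.Icc (-(M : ℤ)) M,
      jap n ^ (-q) * (1 + vdot (S n t) (S (n + 1) t)) ^ (-p) with hFS
  set FU : ℕ → ℝ → ℝ := fun M t => ∑ n ∈ Finset.Icc (-(M : ℤ)) M,
      jap n ^ (-q') * (1 + vdot (U n t) (U (n + 1) t)) ^ (-p') with hFU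
  have hFS0 : ∀ M t, 0 ≤ FS M t := fun M t => Finset.sum_nonneg fun n _ => by
    have h1 := hS.solution.bond_pos n t
    have h2 := one_le_jap n
    positivity
  have hFU0 : ∀ M t, 0 ≤ FU M t := fun M t => Finset.sum_nonneg fun n _ => by
    have h1 := hU.solution.bond_pos n t
    have h2 := one_le_jap n
    positivity
  have hFSc : ∀ M, Continuous (FS M) := hS.solution.continuous_truncation p q
  have hFUc : ∀ M, Continuous (FU M) := hU.solution.continuous_truncation p' q'
  set D := C + C' + 4 * T with hD
  have hint : ∀ M, ∫ t in (0 : ℝ)..T, ((1 + FS M t) + (1 + FU M t)) ≤ D := fun M => by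
    have hc : Continuous fun t => (1 + FS M t) + (1 + FU M t) :=
      (continuous_const.add (hFSc M)).add (continuous_const.add (hFUc M))
    calc ∫ t in (0 : ℝ)..T, ((1 + FS M t) + (1 + FU M t))
        ≤ ∫ t in (-T)..T, ((1 + FS M t) + (1 + FU M t)) := by
          refine intervalIntegral.integral_mono_interval (by linarith) hT.le le_rfl
            (Filter.Eventually.of_forall fun t => ?_) (hc.intervalIntegrable _ _)
          have := hFS0 M t
          have := hFU0 M t
          simp only [Pi.zero_apply]
          positivity
      _ = (∫ t in (-T)..T, FS M t) + (∫ t in (-T)..T, FU M t) + 4 * T := by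
          have e : (fun t => (1 + FS M t) + (1 + FU M t)) = fun t => (FS M t + FU M t) + 2 := by
            ext t; ring
          have hadd : Continuous fun t => FS M t + FU M t := (hFSc M).add (hFUc M)
          rw [e, intervalIntegral.integral_add (hadd.intervalIntegrable _ _)
            intervalIntegrable_const,
            intervalIntegral.integral_add ((hFSc M).intervalIntegrable _ _)
            ((hFUc M).intervalIntegrable _ _), intervalIntegral.integral_const, smul_eq_mul]
          ring
      _ ≤ D := by linarith [hC M, hC' M]
  have hD0 : 0 ≤ D := (intervalIntegral.integral_nonneg hT.le fun t _ => by
    have := hFS0 0 t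
    have := hFU0 0 t
    positivity).trans (hint 0)
  have hmain : ∀ k : ℕ, ‖S n T - U n T‖ ≤
      2 * ((30 * D * ((k : ℝ) + (n.natAbs + 1)) ^ α) ^ k / k.factorial) := fun k => by
    set M := k + n.natAbs with hM
    set w : ℝ := ((M : ℝ) + 1) ^ α with hw
    have hw0 : 0 ≤ w := by positivity
    have hbase : (1 : ℝ) ≤ (M : ℝ) + 1 := by linarith [(Nat.cast_nonneg M : (0 : ℝ) ≤ M)]
    have hbond : ∀ j ∈ Finset.Icc (-(M : ℤ)) M, ∀ t,
        (1 + vdot (S j t) (S (j + 1) t))⁻¹ + (1 + vdot (U j t) (U (j + 1) t))⁻¹ ≤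
          w * ((1 + FS M t) + (1 + FU M t)) := fun j hj t => by
      have h1 := hS.inv_bond_le hj t
      have h2 := hU.inv_bond_le hj t
      have w1 : ((M : ℝ) + 1) ^ (q / p) ≤ w :=
        Real.rpow_le_rpow_of_exponent_le hbase (le_max_left _ _)
      have w2 : ((M : ℝ) + 1) ^ (q' / p') ≤ w :=
        Real.rpow_le_rpow_of_exponent_le hbase (le_max_right _ _)
      have f1 := mul_le_mul_of_nonneg_right w1 (by linarith [hFS0 M t] : 0 ≤ 1 + FS M t)
      have f2 := mul_le_mul_of_nonneg_right w2 (by linarith [hFU0 M t] : 0 ≤ 1 + FU M t)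
      rw [mul_add w]
      exact add_le_add (h1.trans f1) (h2.trans f2)
    have hest := norm_le_pow_div_factorial (f := fun n t => S n t - U n t)
      (m := fun t => 10 * (w * ((1 + FS M t) + (1 + FU M t)))) (M := M) (B := 2)
      (continuous_const.mul (continuous_const.mul
        ((continuous_const.add (hFSc M)).add (continuous_const.add (hFUc M)))))
      (fun t => by
        have := hFS0 M t
        have := hFU0 M t
        positivity)
      (fun n t => (hS.solution.2.2 n t).sub (hU.solution.2.2 n t))
      (fun n => by simp [h0])
      (fun n t => (norm_sub_le _ _).trans
        (by rw [hS.solution.norm_eq_one, hU.solution.norm_eq_one]; norm_num))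
      (fun j t hj => by
        rw [abs_lt] at hj
        exact hS.solution.norm_field_sub_le hU.solution
          (hbond j (Finset.mem_Icc.2 ⟨by linarith, by linarith⟩) t)
          (hbond (j - 1) (Finset.mem_Icc.2 ⟨by linarith, by linarith⟩) t))
      k n T hT.le (by rw [hM]; push_cast; rw [add_comm])
    simp only [intervalIntegral.integral_const_mul] at hest
    have hI0 : 0 ≤ ∫ t in (0 : ℝ)..T, ((1 + FS M t) + (1 + FU M t)) :=
      intervalIntegral.integral_nonneg hT.le fun t _ => by
        have := hFS0 M t
        have := hFU0 M t
        positivity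
    have hwk : ((k : ℝ) + (n.natAbs + 1)) ^ α = w := by
      rw [hw, hM]; push_cast; rw [add_assoc]
    rw [hwk]
    refine hest.trans ?_
    rw [mul_div_assoc]
    gcongr 2 * (?_ ^ k / _)
    nlinarith [mul_le_mul_of_nonneg_left (hint M) hw0]
  have hlim := (tendsto_sublinear_pow_div_factorial (C := 30 * D) (b := n.natAbs + 1)
    (by positivity) hα0 hα1 (by positivity)).const_mul 2
  rw [mul_zero] at hlim
  have hle : ‖S n T - U n T‖ ≤ 0 := ge_of_tendsto' hlim hmain
  exact sub_eq_zero.1 (norm_le_zero_iff.1 hle)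

/-- two global good solutions of the lattice Heisenberg model with the same
initial data coincide. -/
theorem lhm_good_solutions_unique (S U : ℤ → ℝ → R3)
    (hS : IsGoodLHMSolution S) (hU : IsGoodLHMSolution U)
    (h0 : ∀ n : ℤ, S n 0 = U n 0) :
    ∀ (n : ℤ) (t : ℝ), S n t = U n t := by
  obtain ⟨p, q, hS⟩ := HasBondBound.of_good hS
  obtain ⟨p', q', hU⟩ := HasBondBound.of_good hU
  intro n t
  rcases lt_trichotomy t 0 with ht | rfl | ht
  · have h := hS.reverse.eq_of_pos hU.reverse (fun n => by simp [h0]) n (neg_pos.2 ht)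
    simpa using h
  · exact h0 n
  · exact hS.eq_of_pos hU h0 n ht
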